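/- Let a = (a_n)_{n≥1} ∈ ℓ^∞ and, for N ≥ 1 and f ∈ L¹(Ω, ℙ), define the truncated martingale multiplier T_N(a; f) := Σ_{n=1}^N a_n·(𝔼_n[f] − 𝔼_{n−1}[f]). Then for every N ≥ 1, every f ∈ L¹(Ω, ℙ), and every λ > 0, ℙ(|T_N(a; f)| > λ) ≤ 16 ‖a‖_{ℓ^∞} ‖f‖₁ / λ. -/

import Mathlib

open MeasureTheory Filter

/-- Burkholder's special function for the weak-type (1,1) inequality. -/
noncomputable def burkholderU (x y : ℝ) : ℝ :=
  if |x| + |y| ≤ 1 then y ^ 2 - x ^ 2 else 1 - 2 * |x|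

/-- The derivative (outside the unit `ℓ¹` ball, a superderivative) of `burkholderU` at `(x, y)` in
the direction `(p, q)`. -/
noncomputable def burkholderSlope (p q x y : ℝ) : ℝ :=
  if |x| + |y| ≤ 1 then 2 * y * q - 2 * x * p else if 0 ≤ x then -2 * p else 2 * p

lemma burkholderU_le (x y : ℝ) : burkholderU x y ≤ 1 - 2 * |x| := by
  unfold burkholderU
  split_ifs with h
  · nlinarith [sq_abs x, sq_abs y, abs_nonneg x, abs_nonneg y]
  · exact le_rfl

lemma neg_two_mul_abs_le_burkholderU (x y : ℝ) : -2 * |x| ≤ burkholderU x y := by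
  unfold burkholderU
  split_ifs with h
  · nlinarith [sq_abs x, sq_nonneg y, abs_nonneg x, abs_nonneg y]
  · linarith

lemma one_sub_le_burkholderU {x y : ℝ} (h : 1 < |y|) : 1 - 2 * |x| ≤ burkholderU x y := by
  have hx := abs_nonneg x
  rw [burkholderU, if_neg (by linarith)]

lemma burkholderU_nonpos {x y : ℝ} (h : |y| ≤ |x|) : burkholderU x y ≤ 0 := by
  unfold burkholderU
  split_ifs with h'
  · linarith [sq_le_sq.mpr h]
  · linarith

lemma abs_burkholderSlope_le (p q x y : ℝ) :
    |burkholderSlope p q x y| ≤ 2 * |p| + 2 * |q| := by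
  have hp := abs_nonneg p
  have hq := abs_nonneg q
  have hx := abs_nonneg x
  have hy := abs_nonneg y
  unfold burkholderSlope
  split_ifs with h h'
  · refine (abs_sub _ _).trans ?_
    simp only [abs_mul, abs_two]
    nlinarith
  · simp only [abs_mul, abs_neg, abs_two]
    linarith
  · simp only [abs_mul, abs_two]
    linarith

lemma burkholderU_add_le (x y : ℝ) {h k : ℝ} (hk : |k| ≤ |h|) :
    burkholderU (x + h) (y + k) ≤ burkholderU x y + burkholderSlope h k x y := by
  by_cases hD : |x| + |y| ≤ 1
  · rw [burkholderSlope, if_pos hD, burkholderU, burkholderU, if_pos hD]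
    have hsq := sq_le_sq.mpr hk
    have hyk : -(|y| * |h|) ≤ y * k := by
      have h₁ := neg_abs_le (y * k)
      rw [abs_mul] at h₁
      nlinarith [mul_le_mul_of_nonneg_left hk (abs_nonneg y)]
    split_ifs with hD'
    · nlinarith
    · have hx₁ := le_abs_self x
      have hx₂ := neg_abs_le x
      have hy₀ := abs_nonneg y
      have hy₂ := sq_abs y
      rcases le_or_gt |x + h| 1 with hx' | hx'
      · have hlt : 1 - |x + h| < |y + k| := by linarith
        have := sq_abs (y + k)
        have := sq_abs (x + h)
        nlinarith
      · rcases lt_abs.mp hx' with hx' | hx'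
        · rw [abs_of_pos (show 0 < x + h by linarith)]
          rw [abs_of_pos (show 0 < h by linarith)] at hyk
          have : 0 ≤ (1 - (|y| + x)) * (2 * (x + h) - 1 - (|y| + x)) :=
            mul_nonneg (by linarith) (by linarith)
          nlinarith
        · rw [abs_of_neg (show x + h < 0 by linarith)]
          rw [abs_of_neg (show h < 0 by linarith)] at hyk
          have : 0 ≤ (1 - (|y| - x)) * (-2 * (x + h) - 1 - (|y| - x)) :=
            mul_nonneg (by linarith) (by linarith)
          nlinarith
  · refine (burkholderU_le _ _).trans ?_
    rw [burkholderSlope, if_neg hD, burkholderU, if_neg hD]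
    split_ifs with hx
    · rw [abs_of_nonneg hx]
      linarith [le_abs_self (x + h)]
    · rw [abs_of_neg (not_le.mp hx)]
      linarith [neg_abs_le (x + h)]

lemma burkholderSlope_mul (p q d x y : ℝ) :
    burkholderSlope (p * d) (q * d) x y = burkholderSlope p q x y * d := by
  unfold burkholderSlope
  split_ifs <;> ring

lemma measurable_burkholderU : Measurable fun z : ℝ × ℝ ↦ burkholderU z.1 z.2 := by
  unfold burkholderU
  refine Measurable.ite (measurableSet_le ?_ ?_) ?_ ?_ <;> fun_prop

lemma measurable_burkholderSlope (p q : ℝ) :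
    Measurable fun z : ℝ × ℝ ↦ burkholderSlope p q z.1 z.2 := by
  unfold burkholderSlope
  refine Measurable.ite (measurableSet_le ?_ ?_) ?_
    (Measurable.ite (measurableSet_le ?_ ?_) ?_ ?_) <;> fun_prop

section

variable {Ω : Type*} {m m0 : MeasurableSpace Ω} {μ : Measure Ω}

lemma integrable_burkholderU [IsFiniteMeasure μ] {X Y : Ω → ℝ} (hX : Integrable X μ)
    (hY : AEMeasurable Y μ) : Integrable (fun ω ↦ burkholderU (X ω) (Y ω)) μ := by
  refine Integrable.mono' ((integrable_const (1 : ℝ)).add (hX.abs.const_mul 2))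
    (measurable_burkholderU.comp_aemeasurable
      (hX.aemeasurable.prodMk hY)).aestronglyMeasurable (ae_of_all _ fun ω ↦ ?_)
  rw [Real.norm_eq_abs, abs_le]
  have h₁ := burkholderU_le (X ω) (Y ω)
  have h₂ := neg_two_mul_abs_le_burkholderU (X ω) (Y ω)
  have h₃ := abs_nonneg (X ω)
  simp only [Pi.add_apply]
  constructor <;> linarith

lemma integral_mul_eq_zero_of_condExp_eq_zero [IsFiniteMeasure μ] (hm : m ≤ m0) {g d : Ω → ℝ}
    (hg : StronglyMeasurable[m] g) {K : ℝ} (hgK : ∀ ω, |g ω| ≤ K) (hd : Integrable d μ)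
    (hd0 : μ[d | m] =ᵐ[μ] 0) : ∫ ω, g ω * d ω ∂μ = 0 := by
  have h := condExp_stronglyMeasurable_mul_of_bound hm hg hd K (ae_of_all _ hgK)
  calc ∫ ω, g ω * d ω ∂μ = ∫ ω, (μ[g * d | m]) ω ∂μ := (integral_condExp hm).symm
    _ = ∫ _, (0 : ℝ) ∂μ := by
      refine integral_congr_ae ?_
      filter_upwards [h, hd0] with ω h₁ h₂
      rw [h₁, Pi.mul_apply, h₂, Pi.zero_apply, mul_zero]
    _ = 0 := integral_zero _ _

lemma integral_burkholderU_add_le [IsFiniteMeasure μ] (hm : m ≤ m0) {X Y d : Ω → ℝ}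
    (hX : StronglyMeasurable[m] X) (hY : StronglyMeasurable[m] Y) (hXi : Integrable X μ)
    (hd : Integrable d μ) (hd0 : μ[d | m] =ᵐ[μ] 0) {p q : ℝ} (hqp : |q| ≤ |p|) :
    ∫ ω, burkholderU (X ω + p * d ω) (Y ω + q * d ω) ∂μ ≤ ∫ ω, burkholderU (X ω) (Y ω) ∂μ := by
  have hYm : AEMeasurable Y μ := (hY.mono hm).measurable.aemeasurable
  have hS : StronglyMeasurable[m] fun ω ↦ burkholderSlope p q (X ω) (Y ω) :=
    ((measurable_burkholderSlope p q).comp (hX.measurable.prodMk hY.measurable)).stronglyMeasurable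
  have hSK ω := abs_burkholderSlope_le p q (X ω) (Y ω)
  have hSd : Integrable (fun ω ↦ burkholderSlope p q (X ω) (Y ω) * d ω) μ :=
    hd.bdd_mul (hS.mono hm).aestronglyMeasurable (ae_of_all _ hSK)
  have hU := integrable_burkholderU hXi hYm
  calc ∫ ω, burkholderU (X ω + p * d ω) (Y ω + q * d ω) ∂μ
      ≤ ∫ ω, (burkholderU (X ω) (Y ω) + burkholderSlope p q (X ω) (Y ω) * d ω) ∂μ := by
        refine integral_mono (integrable_burkholderU (hXi.add (hd.const_mul p))
          (hYm.add (hd.aemeasurable.const_mul q))) (hU.add hSd) fun ω ↦ ?_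
        have h : |q * d ω| ≤ |p * d ω| := by
          rw [abs_mul, abs_mul]
          exact mul_le_mul_of_nonneg_right hqp (abs_nonneg _)
        simpa only [burkholderSlope_mul] using burkholderU_add_le (X ω) (Y ω) h
    _ = ∫ ω, burkholderU (X ω) (Y ω) ∂μ := by
        rw [integral_add hU hSd, integral_mul_eq_zero_of_condExp_eq_zero hm hS hSK hd hd0, add_zero]

lemma measureReal_one_lt_abs_le [IsFiniteMeasure μ] {X Y : Ω → ℝ} (hX : Integrable X μ)
    (hY : Measurable Y) (h : ∫ ω, burkholderU (X ω) (Y ω) ∂μ ≤ 0) :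
    μ.real {ω | 1 < |Y ω|} ≤ 2 * ∫ ω, |X ω| ∂μ := by
  have hs : MeasurableSet {ω | 1 < |Y ω|} := measurableSet_lt measurable_const hY.abs
  have hX2 := hX.abs.const_mul 2
  have hU := integrable_burkholderU hX hY.aemeasurable
  calc μ.real {ω | 1 < |Y ω|} = ∫ ω, {ω | 1 < |Y ω|}.indicator 1 ω ∂μ :=
        (integral_indicator_one hs).symm
    _ ≤ ∫ ω, (burkholderU (X ω) (Y ω) + 2 * |X ω|) ∂μ := by
        refine integral_mono ((integrable_const 1).indicator hs) (hU.add hX2) fun ω ↦ ?_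
        by_cases hω : 1 < |Y ω|
        · simp only [Set.indicator, Set.mem_ofPred_eq, hω, if_true, Pi.one_apply]
          linarith [one_sub_le_burkholderU (x := X ω) hω]
        · simp only [Set.indicator, Set.mem_ofPred_eq, hω, if_false]
          linarith [neg_two_mul_abs_le_burkholderU (X ω) (Y ω)]
    _ ≤ 2 * ∫ ω, |X ω| ∂μ := by
        rw [integral_add hU hX2, integral_const_mul]
        linarith

/-- The truncated martingale multiplier `∑_{k=1}^n a_k (𝔼_k f - 𝔼_{k-1} f)`, with `𝔼_0 = 0`. -/
noncomputable def truncatedMultiplier (μ : Measure Ω) (ℱ : Filtration ℕ m0) (a : ℕ → ℝ)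
    (f : Ω → ℝ) (n : ℕ) (ω : Ω) : ℝ :=
  ∑ k ∈ Finset.Icc 1 n,
    a k * ((μ[f | ℱ k]) ω - (if k - 1 = 0 then 0 else (μ[f | ℱ (k - 1)]) ω))

lemma truncatedMultiplier_one (ℱ : Filtration ℕ m0) (a : ℕ → ℝ) (f : Ω → ℝ) (ω : Ω) :
    truncatedMultiplier μ ℱ a f 1 ω = a 1 * (μ[f | ℱ 1]) ω := by
  simp [truncatedMultiplier]

lemma truncatedMultiplier_succ (ℱ : Filtration ℕ m0) (a : ℕ → ℝ) (f : Ω → ℝ) {n : ℕ}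
    (hn : 1 ≤ n) (ω : Ω) :
    truncatedMultiplier μ ℱ a f (n + 1) ω = truncatedMultiplier μ ℱ a f n ω +
      a (n + 1) * ((μ[f | ℱ (n + 1)]) ω - (μ[f | ℱ n]) ω) := by
  rw [truncatedMultiplier, Finset.sum_Icc_succ_top (by lia), Nat.add_sub_cancel,
    if_neg (by lia), truncatedMultiplier]

lemma stronglyMeasurable_truncatedMultiplier (ℱ : Filtration ℕ m0) (a : ℕ → ℝ) (f : Ω → ℝ)
    {n : ℕ} (hn : 1 ≤ n) : StronglyMeasurable[ℱ n] (truncatedMultiplier μ ℱ a f n) := by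
  induction n, hn using Nat.le_induction with
  | base =>
    rw [funext (truncatedMultiplier_one ℱ a f)]
    exact stronglyMeasurable_condExp.const_mul _
  | succ n hn ih =>
    rw [funext (truncatedMultiplier_succ ℱ a f hn)]
    have hle := ℱ.mono n.le_succ
    exact (ih.mono hle).add
      ((stronglyMeasurable_condExp.sub (stronglyMeasurable_condExp.mono hle)).const_mul _)

lemma integral_burkholderU_truncatedMultiplier_nonpos [IsFiniteMeasure μ] (ℱ : Filtration ℕ m0)
    {a : ℕ → ℝ} {C : ℝ} (ha : ∀ n, |a n| ≤ C) (f : Ω → ℝ) (r : ℝ) {n : ℕ} (hn : 1 ≤ n) :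
    ∫ ω, burkholderU (r * C * (μ[f | ℱ n]) ω) (r * truncatedMultiplier μ ℱ a f n ω) ∂μ ≤ 0 := by
  have hle k : |r * a k| ≤ |r * C| := by
    rw [abs_mul, abs_mul]
    exact mul_le_mul_of_nonneg_left ((ha k).trans (le_abs_self C)) (abs_nonneg r)
  induction n, hn using Nat.le_induction with
  | base =>
    refine integral_nonpos fun ω ↦ burkholderU_nonpos ?_
    rw [truncatedMultiplier_one, ← mul_assoc, abs_mul, abs_mul (r * C)]
    exact mul_le_mul_of_nonneg_right (hle 1) (abs_nonneg _)
  | succ n hn ih =>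
    refine le_trans (le_of_eq ?_) ((integral_burkholderU_add_le (ℱ.le n)
      (stronglyMeasurable_condExp.const_mul (r * C))
      ((stronglyMeasurable_truncatedMultiplier ℱ a f hn).const_mul r)
      (integrable_condExp.const_mul (r * C))
      (d := μ[f | ℱ (n + 1)] - μ[f | ℱ n]) (integrable_condExp.sub integrable_condExp) ?_
      (hle (n + 1))).trans ih)
    · refine integral_congr_ae (ae_of_all _ fun ω ↦ ?_)
      simp only [truncatedMultiplier_succ ℱ a f hn, Pi.sub_apply]
      congr 1 <;> ring
    · have h₁ := condExp_sub (μ := μ) (m := ℱ n) (integrable_condExp (m := ℱ (n + 1)) (f := f))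
        (integrable_condExp (m := ℱ n) (f := f))
      have h₂ := condExp_condExp_of_le (μ := μ) (f := f) (ℱ.mono n.le_succ) (ℱ.le (n + 1))
      have h₃ := condExp_condExp_of_le (μ := μ) (f := f) (le_refl (ℱ n)) (ℱ.le n)
      filter_upwards [h₁, h₂, h₃] with ω h₁ h₂ h₃
      rw [h₁, Pi.sub_apply, h₂, h₃, sub_self, Pi.zero_apply]

end

/-- **Weak-type (1,1) estimate for truncated martingale multipliers** (Theorem 4.1).
For `a ∈ ℓ^∞` (with `‖a‖_{ℓ^∞} ≤ C`), `N ≥ 1`, `f ∈ L¹(Ω, ℙ)` and `λ > 0`,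
`T_N(a; f) := Σ_{n=1}^N a_n (𝔼_n f − 𝔼_{n−1} f)` (with `𝔼_0 ≡ 0`) satisfies
`ℙ(|T_N(a; f)| > λ) ≤ 16 C ‖f‖₁ / λ`. -/
theorem truncated_multiplier_weak_type_one_one
    {Ω : Type*} {m0 : MeasurableSpace Ω} {μ : Measure Ω} [IsProbabilityMeasure μ]
    (ℱ : Filtration ℕ m0)
    (a : ℕ → ℝ) (C : ℝ) (ha : ∀ n, |a n| ≤ C)
    (N : ℕ) (hN : 1 ≤ N)
    (f : Ω → ℝ) (hf_int : Integrable f μ)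
    (lam : ℝ) (hlam : 0 < lam) :
    μ {ω | lam <
        |∑ n ∈ Finset.Icc 1 N,
          a n * ((μ[f | ℱ n]) ω - (if n - 1 = 0 then 0 else (μ[f | ℱ (n - 1)]) ω))|}
      ≤ ENNReal.ofReal (16 * C * (∫ ω, |f ω| ∂μ) / lam) := by
  have hC : 0 ≤ C := (abs_nonneg _).trans (ha 0)
  have hr : 0 ≤ lam⁻¹ * C := mul_nonneg (inv_nonneg.mpr hlam.le) hC
  have hset : {ω | lam < |truncatedMultiplier μ ℱ a f N ω|} =
      {ω | 1 < |lam⁻¹ * truncatedMultiplier μ ℱ a f N ω|} := by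
    ext ω
    simp only [Set.mem_ofPred_eq]
    rw [abs_mul, abs_of_pos (inv_pos.mpr hlam), lt_inv_mul_iff₀ hlam, mul_one]
  have hweak := measureReal_one_lt_abs_le (integrable_condExp.const_mul (lam⁻¹ * C))
    (((stronglyMeasurable_truncatedMultiplier ℱ a f hN).mono (ℱ.le N)).measurable.const_mul lam⁻¹)
    (integral_burkholderU_truncatedMultiplier_nonpos (μ := μ) ℱ ha f lam⁻¹ hN)
  have hL1 : ∫ ω, |(μ[f | ℱ N]) ω| ∂μ ≤ ∫ ω, |f ω| ∂μ := integral_abs_condExp_le f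
  have hf0 : 0 ≤ ∫ ω, |f ω| ∂μ := integral_nonneg fun ω ↦ abs_nonneg _
  change μ {ω | lam < |truncatedMultiplier μ ℱ a f N ω|} ≤ _
  rw [hset, ← ofReal_measureReal]
  refine ENNReal.ofReal_le_ofReal (hweak.trans ?_)
  simp only [abs_mul (lam⁻¹ * C), abs_of_nonneg hr]
  rw [integral_const_mul]
  calc 2 * (lam⁻¹ * C * ∫ ω, |(μ[f | ℱ N]) ω| ∂μ)
      ≤ 16 * (lam⁻¹ * C * ∫ ω, |f ω| ∂μ) := by
        have := mul_le_mul_of_nonneg_left hL1 hr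
        have := mul_nonneg hr hf0
        linarith
    _ = 16 * C * (∫ ω, |f ω| ∂μ) / lam := by ring
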